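/- The restricted quantum group U is factorizable: writing M ∈ U ⊗ U for the unique element with (ι⊗ι)(M) = R₂₁R, the ℂ-linear map from the dual space U* to U sending f to (f ⊗ id)(M) is bijective. -/

import Mathlib

open scoped TensorProduct
open Finset

noncomputable section

namespace LogHennings

/-- `q = exp(iπ/p)`. -/
def qq (p : ℕ) : ℂ := Complex.exp ((Real.pi : ℂ) * Complex.I / (p : ℂ))

/-- `q^{1/2} = exp(iπ/(2p))`. -/
def qh (p : ℕ) : ℂ := Complex.exp ((Real.pi : ℂ) * Complex.I / (2 * (p : ℂ)))

/-- quantum integer `[m] = (q^m - q^{-m})/(q - q⁻¹)`. -/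
def qnum (p m : ℕ) : ℂ := ((qq p) ^ m - (qq p)⁻¹ ^ m) / (qq p - (qq p)⁻¹)

/-- quantum factorial `[m]! = [m][m-1]⋯[1]`. -/
def qfac (p : ℕ) : ℕ → ℂ
  | 0 => 1
  | m + 1 => qnum p (m + 1) * qfac p m

/-- Generators of the restricted quantum group `U`. -/
inductive UGen | E | F | K | Kinv

abbrev FU := FreeAlgebra ℂ UGen

def fE : FU := FreeAlgebra.ι ℂ UGen.E
def fF : FU := FreeAlgebra.ι ℂ UGen.F
def fK : FU := FreeAlgebra.ι ℂ UGen.K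
def fKinv : FU := FreeAlgebra.ι ℂ UGen.Kinv

/-- Defining relations of the restricted quantum group `U`. -/
inductive URel (p : ℕ) : FU → FU → Prop
  | Epow : URel p (fE ^ p) 0
  | Fpow : URel p (fF ^ p) 0
  | Kpow : URel p (fK ^ (2 * p)) 1
  | KKinv : URel p (fK * fKinv) 1
  | KinvK : URel p (fKinv * fK) 1
  | KE : URel p (fK * fE * fKinv) ((qq p) ^ 2 • fE)
  | KF : URel p (fK * fF * fKinv) (((qq p) ^ 2)⁻¹ • fF)
  | EF : URel p (fE * fF - fF * fE) ((qq p - (qq p)⁻¹)⁻¹ • (fK - fKinv))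

/-- The restricted quantum group `U = \bar U_q(sl2)`. -/
abbrev Uq (p : ℕ) := RingQuot (URel p)

def UE (p : ℕ) : Uq p := RingQuot.mkAlgHom ℂ (URel p) fE
def UF (p : ℕ) : Uq p := RingQuot.mkAlgHom ℂ (URel p) fF
def UK (p : ℕ) : Uq p := RingQuot.mkAlgHom ℂ (URel p) fK
def UKinv (p : ℕ) : Uq p := RingQuot.mkAlgHom ℂ (URel p) fKinv

/-- Generators of the braided extension `D`. -/
inductive DGen | e | phi | k | kinv

abbrev FD := FreeAlgebra ℂ DGen

def fe : FD := FreeAlgebra.ι ℂ DGen.e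
def fphi : FD := FreeAlgebra.ι ℂ DGen.phi
def fk : FD := FreeAlgebra.ι ℂ DGen.k
def fkinv : FD := FreeAlgebra.ι ℂ DGen.kinv

/-- Defining relations of `D`. -/
inductive DRel (p : ℕ) : FD → FD → Prop
  | epow : DRel p (fe ^ p) 0
  | phipow : DRel p (fphi ^ p) 0
  | kpow : DRel p (fk ^ (4 * p)) 1
  | kkinv : DRel p (fk * fkinv) 1
  | kinvk : DRel p (fkinv * fk) 1
  | ke : DRel p (fk * fe * fkinv) (qq p • fe)
  | kphi : DRel p (fk * fphi * fkinv) ((qq p)⁻¹ • fphi)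
  | ephi : DRel p (fe * fphi - fphi * fe)
      ((qq p - (qq p)⁻¹)⁻¹ • (fk ^ 2 - fkinv ^ 2))

/-- The braided extension `D` of `U`. -/
abbrev Dq (p : ℕ) := RingQuot (DRel p)

def De (p : ℕ) : Dq p := RingQuot.mkAlgHom ℂ (DRel p) fe
def Dphi (p : ℕ) : Dq p := RingQuot.mkAlgHom ℂ (DRel p) fphi
def Dk (p : ℕ) : Dq p := RingQuot.mkAlgHom ℂ (DRel p) fk
def Dkinv (p : ℕ) : Dq p := RingQuot.mkAlgHom ℂ (DRel p) fkinv

/-- The `R`-matrix of `D`. -/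
def Rmat (p : ℕ) : Dq p ⊗[ℂ] Dq p :=
  ((4 * (p : ℂ))⁻¹) •
    ∑ m ∈ range p, ∑ n ∈ range (4 * p), ∑ j ∈ range (4 * p),
      (((qq p - (qq p)⁻¹) ^ m / qfac p m) *
          (qh p) ^ ((m : ℤ) * ((m : ℤ) - 1) + 2 * (m : ℤ) * ((n : ℤ) - (j : ℤ))
            - (n : ℤ) * (j : ℤ))) •
        ((De p ^ m * Dk p ^ n) ⊗ₜ[ℂ] (Dphi p ^ m * Dk p ^ j))

/-- `R₂₁ = τ(R)`. -/
def R21 (p : ℕ) : Dq p ⊗[ℂ] Dq p := TensorProduct.comm ℂ (Dq p) (Dq p) (Rmat p)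

/-- The monodromy `M = R₂₁ R`. -/
def Mmat (p : ℕ) : Dq p ⊗[ℂ] Dq p := R21 p * Rmat p

/-- The ribbon element `r ∈ D`. -/
def rib (p : ℕ) : Dq p :=
  ((1 - Complex.I) / (2 * (Real.sqrt p : ℂ))) •
    ∑ m ∈ range p, ∑ j ∈ range (2 * p),
      (((qq p - (qq p)⁻¹) ^ m / qfac p m) *
          (qh p) ^ (-(m : ℤ) + 2 * (m : ℤ) * (j : ℤ) + ((j : ℤ) + (p : ℤ) + 1) ^ 2)) •
        (Dphi p ^ m * De p ^ m * Dk p ^ (2 * j))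

/-- The Drinfeld element `u = Σ S(β_i) α_i` for `R = Σ α_i ⊗ β_i`,
depending on a choice of antipode `S`. -/
def drinfeldU (p : ℕ) (S : Dq p →ₗ[ℂ] Dq p) : Dq p :=
  LinearMap.mul' ℂ (Dq p) (TensorProduct.map S LinearMap.id (R21 p))

/-- `Δ` takes the prescribed values on the generators of `U`. -/
def IsDeltaU (p : ℕ) (Δ : Uq p →ₐ[ℂ] Uq p ⊗[ℂ] Uq p) : Prop :=
  Δ (UE p) = 1 ⊗ₜ[ℂ] UE p + UE p ⊗ₜ[ℂ] UK p ∧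
  Δ (UF p) = UKinv p ⊗ₜ[ℂ] UF p + UF p ⊗ₜ[ℂ] 1 ∧
  Δ (UK p) = UK p ⊗ₜ[ℂ] UK p ∧
  Δ (UKinv p) = UKinv p ⊗ₜ[ℂ] UKinv p

/-- `ε` takes the prescribed values on the generators of `U`. -/
def IsCounitU (p : ℕ) (ε : Uq p →ₐ[ℂ] ℂ) : Prop :=
  ε (UE p) = 0 ∧ ε (UF p) = 0 ∧ ε (UK p) = 1 ∧ ε (UKinv p) = 1

/-- `S` is an algebra anti-homomorphism taking the prescribed values on the
generators of `U`. -/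
def IsAntipodeU (p : ℕ) (S : Uq p →ₗ[ℂ] Uq p) : Prop :=
  S 1 = 1 ∧ (∀ x y, S (x * y) = S y * S x) ∧
  S (UE p) = -(UE p * UKinv p) ∧ S (UF p) = -(UK p * UF p) ∧
  S (UK p) = UKinv p ∧ S (UKinv p) = UK p

/-- `Δ` takes the prescribed values on the generators of `D`. -/
def IsDeltaD (p : ℕ) (Δ : Dq p →ₐ[ℂ] Dq p ⊗[ℂ] Dq p) : Prop :=
  Δ (De p) = 1 ⊗ₜ[ℂ] De p + De p ⊗ₜ[ℂ] (Dk p ^ 2) ∧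
  Δ (Dphi p) = (Dkinv p ^ 2) ⊗ₜ[ℂ] Dphi p + Dphi p ⊗ₜ[ℂ] 1 ∧
  Δ (Dk p) = Dk p ⊗ₜ[ℂ] Dk p ∧
  Δ (Dkinv p) = Dkinv p ⊗ₜ[ℂ] Dkinv p

/-- `ε` takes the prescribed values on the generators of `D`. -/
def IsCounitD (p : ℕ) (ε : Dq p →ₐ[ℂ] ℂ) : Prop :=
  ε (De p) = 0 ∧ ε (Dphi p) = 0 ∧ ε (Dk p) = 1 ∧ ε (Dkinv p) = 1

/-- `S` is an algebra anti-homomorphism taking the prescribed values on the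
generators of `D`. -/
def IsAntipodeD (p : ℕ) (S : Dq p →ₗ[ℂ] Dq p) : Prop :=
  S 1 = 1 ∧ (∀ x y, S (x * y) = S y * S x) ∧
  S (De p) = -(De p * Dkinv p ^ 2) ∧ S (Dphi p) = -(Dk p ^ 2 * Dphi p) ∧
  S (Dk p) = Dkinv p ∧ S (Dkinv p) = Dk p

/-- `ι` takes the prescribed values `E ↦ e`, `F ↦ φ`, `K^{±1} ↦ k^{±2}`. -/
def IsIota (p : ℕ) (ι : Uq p →ₐ[ℂ] Dq p) : Prop :=
  ι (UE p) = De p ∧ ι (UF p) = Dphi p ∧ ι (UK p) = Dk p ^ 2 ∧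
  ι (UKinv p) = Dkinv p ^ 2

/-- `μ` takes the prescribed values on the PBW basis of `U`. -/
def IsMu (p : ℕ) (μ : Uq p →ₗ[ℂ] ℂ) : Prop :=
  ∀ m n l : ℕ, m < p → n < p → l < 2 * p →
    μ (UE p ^ m * UF p ^ n * UK p ^ l) =
      if m = p - 1 ∧ n = p - 1 ∧ l = p + 1 then
        -((Real.sqrt (2 / (p : ℝ)) : ℂ)) * (qfac p (p - 1)) ^ 2
      else 0

variable {A : Type*} [Ring A] [Algebra ℂ A]

/-- Coassociativity of a comultiplication. -/
def Coassoc (Δ : A →ₐ[ℂ] A ⊗[ℂ] A) : Prop :=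
  ∀ x, TensorProduct.assoc ℂ A A A
      (TensorProduct.map Δ.toLinearMap LinearMap.id (Δ x)) =
    TensorProduct.map LinearMap.id Δ.toLinearMap (Δ x)

/-- The counit axiom. -/
def CounitAxiom (Δ : A →ₐ[ℂ] A ⊗[ℂ] A) (ε : A →ₐ[ℂ] ℂ) : Prop :=
  (∀ x, TensorProduct.lid ℂ A
      (TensorProduct.map ε.toLinearMap LinearMap.id (Δ x)) = x) ∧
  (∀ x, TensorProduct.rid ℂ A
      (TensorProduct.map LinearMap.id ε.toLinearMap (Δ x)) = x)

/-- The antipode axiom. -/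
def AntipodeAxiom (Δ : A →ₐ[ℂ] A ⊗[ℂ] A) (ε : A →ₐ[ℂ] ℂ)
    (S : A →ₗ[ℂ] A) : Prop :=
  (∀ x, LinearMap.mul' ℂ A (TensorProduct.map S LinearMap.id (Δ x)) = ε x • 1) ∧
  (∀ x, LinearMap.mul' ℂ A (TensorProduct.map LinearMap.id S (Δ x)) = ε x • 1)

/-- `x ↦ x ⊗ 1`. -/
def e1 (p : ℕ) : Dq p →ₗ[ℂ] Dq p ⊗[ℂ] Dq p :=
  (TensorProduct.mk ℂ (Dq p) (Dq p)).flip 1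

/-- `x ↦ 1 ⊗ x`. -/
def e2 (p : ℕ) : Dq p →ₗ[ℂ] Dq p ⊗[ℂ] Dq p :=
  TensorProduct.mk ℂ (Dq p) (Dq p) 1

/-- The balancing element `g = K^{p+1}`. -/
def gU (p : ℕ) : Uq p := UK p ^ (p + 1)

/-- The span of commutators `[U,U]`. -/
def commSpan (p : ℕ) : Submodule ℂ (Uq p) :=
  Submodule.span ℂ {z : Uq p | ∃ x y : Uq p, z = x * y - y * x}

end LogHennings

namespace LogHennings

/-! ### Scalars -/

lemma qh_ne (p : ℕ) : qh p ≠ 0 := Complex.exp_ne_zero _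
lemma qq_ne (p : ℕ) : qq p ≠ 0 := Complex.exp_ne_zero _

lemma qq_eq (p : ℕ) : qq p = qh p ^ 2 := by
  unfold qq qh
  rw [← Complex.exp_nat_mul]
  congr 1
  push_cast
  rw [mul_div_assoc', mul_div_mul_left _ _ two_ne_zero]

lemma qh_prim (p : ℕ) (hp : 2 ≤ p) : IsPrimitiveRoot (qh p) (4 * p) := by
  have := Complex.isPrimitiveRoot_exp (4 * p) (by omega)
  convert this using 1
  unfold qh
  congr 1
  have : (p : ℂ) ≠ 0 := by exact_mod_cast (by omega : p ≠ 0)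
  push_cast
  field_simp
  ring

lemma qq_prim (p : ℕ) (hp : 2 ≤ p) : IsPrimitiveRoot (qq p) (2 * p) := by
  rw [qq_eq]
  exact (qh_prim p hp).pow (by omega) (by ring)

lemma qsub_eq (p m : ℕ) : qq p ^ m - (qq p)⁻¹ ^ m = (qq p)⁻¹ ^ m * (qq p ^ (2 * m) - 1) := by
  have := qq_ne p
  rw [inv_pow, two_mul, pow_add]
  field_simp

lemma qsub_ne (p m : ℕ) (hp : 2 ≤ p) (h0 : 0 < m) (hm : m < p) :
    qq p ^ m - (qq p)⁻¹ ^ m ≠ 0 := by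
  rw [qsub_eq]
  refine mul_ne_zero (pow_ne_zero _ (inv_ne_zero (qq_ne p))) (sub_ne_zero.2 ?_)
  exact (qq_prim p hp).pow_ne_one_of_pos_of_lt (by omega) (by omega)

lemma del_ne (p : ℕ) (hp : 2 ≤ p) : qq p - (qq p)⁻¹ ≠ 0 := by
  simpa using qsub_ne p 1 hp one_pos (by omega)

lemma qnum_p (p : ℕ) (hp : 2 ≤ p) : qnum p p = 0 := by
  unfold qnum
  rw [qsub_eq, (qq_prim p hp).pow_eq_one]
  simp

lemma qnum_zero (p : ℕ) : qnum p 0 = 0 := by simp [qnum]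

lemma qfac_ne (p : ℕ) (hp : 2 ≤ p) (m : ℕ) (hm : m < p) : qfac p m ≠ 0 := by
  induction m with
  | zero => simp [qfac]
  | succ m ih =>
    rw [qfac]
    exact mul_ne_zero (div_ne_zero (qsub_ne p _ hp (by omega) hm) (del_ne p hp)) (ih (by omega))

/-- orthogonality of characters -/
lemma sum_char {M : Type*} [AddCommGroup M] [Module ℂ M] (p : ℕ) (hp : 2 ≤ p) (s : ℤ) (g : ℕ → M) :
    ∑ n ∈ range (4 * p), ∑ j ∈ range (4 * p), (qh p ^ ((j : ℤ) * (s - n))) • g n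
      = (4 * (p : ℂ)) • g (s % (4 * p : ℕ)).toNat := by
  have hN : 0 < 4 * p := by omega
  have hs0 : 0 ≤ s % (4 * p : ℕ) := Int.emod_nonneg _ (by omega)
  have hs1 : s % (4 * p : ℕ) < (4 * p : ℕ) := Int.emod_lt_of_pos _ (by omega)
  rw [Finset.sum_eq_single (s % (4 * p : ℕ)).toNat]
  · have : ∀ j ∈ range (4 * p),
        (qh p ^ ((j : ℤ) * (s - ((s % (4 * p : ℕ)).toNat : ℤ)))) • g (s % (4 * p : ℕ)).toNat
        = g (s % (4 * p : ℕ)).toNat := by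
      intro j _
      rw [Int.toNat_of_nonneg hs0, ((qh_prim p hp).zpow_eq_one_iff_dvd _).2, one_smul]
      exact Dvd.dvd.mul_left (Int.dvd_self_sub_emod) _
    rw [Finset.sum_congr rfl this]
    rw [Finset.sum_const, Finset.card_range, ← Nat.cast_smul_eq_nsmul ℂ (4 * p)]
    push_cast; rfl
  · intro n hn hne
    rw [← Finset.sum_smul]
    have hz : qh p ^ (s - n) ≠ 1 := by
      rw [Ne, (qh_prim p hp).zpow_eq_one_iff_dvd]
      intro hd
      apply hne
      have hn' := Finset.mem_range.1 hn
      have : s % (4 * p : ℕ) = (n : ℤ) % (4 * p : ℕ) :=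
        Int.emod_eq_emod_iff_emod_sub_eq_zero.2 (Int.emod_eq_zero_of_dvd hd)
      rw [this, Int.emod_eq_of_lt (by omega) (by omega)]
      simp
    have h1 : ∑ j ∈ range (4 * p), qh p ^ ((j : ℤ) * (s - n))
        = ∑ j ∈ range (4 * p), (qh p ^ (s - n)) ^ j := by
      refine Finset.sum_congr rfl fun j _ => ?_
      rw [mul_comm, zpow_mul, zpow_natCast]
    rw [h1, geom_sum_eq hz, ← zpow_natCast, ← zpow_mul, mul_comm, zpow_mul, zpow_natCast,
      (qh_prim p hp).pow_eq_one]
    simp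
  · intro h
    exfalso; apply h
    rw [Finset.mem_range]; omega

/-! ### The modules -/

abbrev VV (p : ℕ) := (Fin p × Fin p) →₀ ℂ

def ww (p a b : ℕ) : VV p :=
  if h : a < p ∧ b < p then Finsupp.single (⟨a, h.1⟩, ⟨b, h.2⟩) 1 else 0

lemma ww_of (p : ℕ) (i : Fin p × Fin p) : ww p i.1 i.2 = Finsupp.single i 1 := by
  simp [ww]

lemma ww_zero (p a b : ℕ) (h : ¬ (a < p ∧ b < p)) : ww p a b = 0 := by
  simp [ww, h]

def cc (p : ℕ) (t : ℤ) (a b : ℕ) : ℂ :=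
  qnum p a * (qh p ^ (2 * t + 2 * a - 2 - 4 * b) - qh p ^ (-(2 * t + 2 * a - 2 - 4 * b)))
    / (qq p - (qq p)⁻¹)

def opE (p : ℕ) : Module.End ℂ (VV p) :=
  Finsupp.linearCombination ℂ (fun i : Fin p × Fin p => ww p (i.1 + 1) i.2)

def opK (p : ℕ) (t : ℤ) : Module.End ℂ (VV p) :=
  Finsupp.linearCombination ℂ
    (fun i : Fin p × Fin p => qh p ^ (t + 2 * (i.1 : ℕ) - 2 * (i.2 : ℕ)) • ww p i.1 i.2)

def opKi (p : ℕ) (t : ℤ) : Module.End ℂ (VV p) :=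
  Finsupp.linearCombination ℂ
    (fun i : Fin p × Fin p => qh p ^ (-(t + 2 * (i.1 : ℕ) - 2 * (i.2 : ℕ))) • ww p i.1 i.2)

def opF (p : ℕ) (t : ℤ) : Module.End ℂ (VV p) :=
  Finsupp.linearCombination ℂ
    (fun i : Fin p × Fin p => ww p i.1 (i.2 + 1) - cc p t i.1 i.2 • ww p (i.1 - 1) i.2)

lemma ww_ext (p : ℕ) {M : Type*} [AddCommGroup M] [Module ℂ M] (f g : VV p →ₗ[ℂ] M)
    (h : ∀ a b, f (ww p a b) = g (ww p a b)) : f = g := by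
  apply Finsupp.lhom_ext'
  intro i
  ext
  simpa [ww_of] using h i.1 i.2

lemma lc_ww (p : ℕ) (g : ℕ → ℕ → VV p) (hg : ∀ a b, ¬ (a < p ∧ b < p) → g a b = 0) (a b : ℕ) :
    Finsupp.linearCombination ℂ (fun i : Fin p × Fin p => g i.1 i.2) (ww p a b) = g a b := by
  by_cases h : a < p ∧ b < p
  · simp [ww, h]
  · rw [ww_zero _ _ _ h, map_zero, hg _ _ h]

lemma opE_ww (p a b : ℕ) : opE p (ww p a b) = ww p (a + 1) b :=
  lc_ww p (fun a b => ww p (a + 1) b) (fun a b h => ww_zero _ _ _ (by omega)) a b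

lemma opK_ww (p : ℕ) (t : ℤ) (a b : ℕ) :
    opK p t (ww p a b) = qh p ^ (t + 2 * a - 2 * b) • ww p a b :=
  lc_ww p (fun a b => qh p ^ (t + 2 * a - 2 * b) • ww p a b)
    (fun a b h => by rw [ww_zero _ _ _ h, smul_zero]) a b

lemma opKi_ww (p : ℕ) (t : ℤ) (a b : ℕ) :
    opKi p t (ww p a b) = qh p ^ (-(t + 2 * a - 2 * b)) • ww p a b :=
  lc_ww p (fun a b => qh p ^ (-(t + 2 * a - 2 * b)) • ww p a b)
    (fun a b h => by rw [ww_zero _ _ _ h, smul_zero]) a b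

lemma opF_ww (p : ℕ) (hp : 2 ≤ p) (t : ℤ) (a b : ℕ) :
    opF p t (ww p a b) = ww p a (b + 1) - cc p t a b • ww p (a - 1) b := by
  refine lc_ww p (fun a b => ww p a (b + 1) - cc p t a b • ww p (a - 1) b) (fun a b h => ?_) a b
  rw [ww_zero p a (b + 1) (by omega)]
  by_cases h1 : a = p
  · subst h1
    simp [cc, qnum_p a hp]
  · rw [ww_zero p (a - 1) b (by omega)]
    simp

lemma opE_pow (p n a b : ℕ) : (opE p ^ n) (ww p a b) = ww p (a + n) b := by
  induction n with
  | zero => simp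
  | succ n ih => rw [pow_succ', Module.End.mul_apply, ih, opE_ww]; rfl

lemma opK_pow (p : ℕ) (t : ℤ) (n a b : ℕ) :
    (opK p t ^ n) (ww p a b) = qh p ^ ((n : ℤ) * (t + 2 * a - 2 * b)) • ww p a b := by
  induction n with
  | zero => simp
  | succ n ih =>
    rw [pow_succ', Module.End.mul_apply, ih, map_smul, opK_ww, smul_smul,
      ← zpow_add₀ (qh_ne p)]
    congr 2
    push_cast; ring

lemma opF_pow (p : ℕ) (hp : 2 ≤ p) (t : ℤ) (n b : ℕ) :
    (opF p t ^ n) (ww p 0 b) = ww p 0 (b + n) := by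
  induction n with
  | zero => simp
  | succ n ih =>
    rw [pow_succ', Module.End.mul_apply, ih, opF_ww p hp]
    simp [cc, qnum_zero, add_assoc]

/-- commutation of `e` with powers of `φ` in any algebra. -/
lemma comm_pow {A : Type*} [Ring A] [Algebra ℂ A] (p : ℕ) (hp : 2 ≤ p) (e f K L : A)
    (hef : e * f - f * e = (qq p - (qq p)⁻¹)⁻¹ • (K - L))
    (hK : K * f = (qq p ^ 2)⁻¹ • (f * K)) (hL : L * f = (qq p ^ 2) • (f * L)) (n : ℕ) :
    e * f ^ (n + 1) = f ^ (n + 1) * e + (qnum p (n + 1) * (qq p - (qq p)⁻¹)⁻¹) •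
      (f ^ n * ((qq p ^ n)⁻¹ • K - qq p ^ n • L)) := by
  have hq := qq_ne p
  have hd := del_ne p hp
  have hef' : e * f = f * e + (qq p - (qq p)⁻¹)⁻¹ • (K - L) := by rw [← hef]; abel
  induction n with
  | zero =>
    have : qnum p 1 = 1 := by simp [qnum, hd]
    simp [this, hef']
  | succ n ih =>
    rw [pow_succ f (n + 1), ← mul_assoc, ih]
    rw [add_mul, mul_assoc _ e f, hef', smul_mul_assoc, mul_assoc _ _ f, sub_mul,
      smul_mul_assoc, smul_mul_assoc, hK, hL]
    simp only [mul_add, mul_sub, smul_sub, smul_smul, mul_smul_comm, ← mul_assoc, ← pow_succ]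
    have e1 : qnum p (n + 1 + 1) * (qq p - (qq p)⁻¹)⁻¹ * (qq p ^ (n + 1))⁻¹
        = (qq p - (qq p)⁻¹)⁻¹ +
          qnum p (n + 1) * (qq p - (qq p)⁻¹)⁻¹ * ((qq p ^ n)⁻¹ * (qq p ^ 2)⁻¹) := by
      have hd' : qq p ^ 2 - 1 ≠ 0 := by
        intro h; apply hd; field_simp; rw [h, mul_zero]
      unfold qnum
      simp only [inv_pow]
      field_simp
      ring
    have e2 : qnum p (n + 1 + 1) * (qq p - (qq p)⁻¹)⁻¹ * (qq p ^ (n + 1))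
        = (qq p - (qq p)⁻¹)⁻¹ +
          qnum p (n + 1) * (qq p - (qq p)⁻¹)⁻¹ * ((qq p ^ n) * (qq p ^ 2)) := by
      have hd' : qq p ^ 2 - 1 ≠ 0 := by
        intro h; apply hd; field_simp; rw [h, mul_zero]
      unfold qnum
      simp only [inv_pow]
      field_simp
      ring
    rw [e1, e2, add_smul, add_smul]
    simp only [mul_assoc]
    abel

lemma opEF (p : ℕ) (hp : 2 ≤ p) (t : ℤ) :
    opE p * opF p t - opF p t * opE p
      = (qq p - (qq p)⁻¹)⁻¹ • (opK p t ^ 2 - opKi p t ^ 2) := by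
  apply ww_ext
  intro a b
  have key : cc p t (a + 1) b - cc p t a b = (qq p - (qq p)⁻¹)⁻¹ *
      (qh p ^ (t + 2 * a - 2 * b) * qh p ^ (t + 2 * a - 2 * b)
        - qh p ^ (-(t + 2 * a - 2 * b)) * qh p ^ (-(t + 2 * a - 2 * b))) := by
    have hd := del_ne p hp
    have hh := qh_ne p
    unfold cc qnum
    rw [div_mul_eq_mul_div, div_mul_eq_mul_div, div_div, div_div, ← sub_div,
      div_eq_iff (mul_ne_zero hd hd), mul_comm (qq p - (qq p)⁻¹)⁻¹, mul_assoc,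
      inv_mul_cancel_left₀ hd]
    rw [qq_eq, ← inv_pow, ← pow_mul, ← pow_mul, ← pow_mul, ← pow_mul, inv_pow, inv_pow, inv_pow]
    simp only [← zpow_natCast, ← zpow_neg]
    simp only [mul_sub, sub_mul, ← zpow_add₀ hh]
    push_cast
    ring_nf
  have h0 : ww p (a - 1 + 1) b = ww p a b ∨ a = 0 := by
    rcases a with _ | a
    · right; rfl
    · left; rfl
  have h1 : cc p t a b • ww p (a - 1 + 1) b = cc p t a b • ww p a b := by
    rcases h0 with h0 | h0
    · rw [h0]
    · subst h0; simp [cc, qnum_zero]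
  simp only [LinearMap.sub_apply, Module.End.mul_apply, opF_ww p hp, opE_ww, map_sub, map_smul,
    LinearMap.smul_apply, pow_two, opK_ww, opKi_ww, h1, smul_smul, ← sub_smul]
  rw [← key, sub_smul]
  simp

lemma opK_Ki (p : ℕ) (t : ℤ) : opK p t * opKi p t = 1 := by
  apply ww_ext
  intro a b
  rw [Module.End.mul_apply, opKi_ww, map_smul, opK_ww, smul_smul, ← zpow_add₀ (qh_ne p)]
  simp

lemma opKi_K (p : ℕ) (t : ℤ) : opKi p t * opK p t = 1 := by
  apply ww_ext
  intro a b
  rw [Module.End.mul_apply, opK_ww, map_smul, opKi_ww, smul_smul, ← zpow_add₀ (qh_ne p)]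
  simp

lemma opKE (p : ℕ) (t : ℤ) : opK p t * opE p = qq p • (opE p * opK p t) := by
  apply ww_ext
  intro a b
  simp only [Module.End.mul_apply, LinearMap.smul_apply, opE_ww, opK_ww, map_smul, smul_smul,
    qq_eq]
  rw [← zpow_natCast, ← zpow_add₀ (qh_ne p)]
  congr 2
  push_cast; ring

lemma opKF (p : ℕ) (hp : 2 ≤ p) (t : ℤ) :
    opK p t * opF p t = (qq p)⁻¹ • (opF p t * opK p t) := by
  apply ww_ext
  intro a b
  have h1 : qh p ^ (t + 2 * a - 2 * ((b + 1 : ℕ) : ℤ))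
      = (qq p)⁻¹ * qh p ^ (t + 2 * a - 2 * b) := by
    rw [qq_eq, ← zpow_natCast, ← zpow_neg, ← zpow_add₀ (qh_ne p)]
    congr 1
    push_cast; ring
  have h2 : cc p t a b * qh p ^ (t + 2 * ((a - 1 : ℕ) : ℤ) - 2 * b)
      = cc p t a b * ((qq p)⁻¹ * qh p ^ (t + 2 * a - 2 * b)) := by
    rcases a with _ | a
    · simp [cc, qnum_zero]
    · rw [qq_eq, ← zpow_natCast, ← zpow_neg, ← zpow_add₀ (qh_ne p)]
      congr 2
      push_cast
      ring
  simp only [Module.End.mul_apply, LinearMap.smul_apply, opF_ww p hp, opK_ww, map_smul, map_sub,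
    smul_smul, smul_sub, h1, h2]
  rw [mul_comm (cc p t a b), mul_assoc]

lemma opKiF (p : ℕ) (hp : 2 ≤ p) (t : ℤ) :
    opKi p t * opF p t = qq p • (opF p t * opKi p t) := by
  calc opKi p t * opF p t
      = qq p • (opKi p t * ((qq p)⁻¹ • (opF p t * opK p t)) * opKi p t) := by
        rw [mul_smul_comm, smul_mul_assoc, smul_smul, mul_inv_cancel₀ (qq_ne p), one_smul,
          mul_assoc, mul_assoc, opK_Ki, mul_one]
    _ = _ := by rw [← opKF p hp, ← mul_assoc, opKi_K, one_mul]

lemma opF_p (p : ℕ) (hp : 2 ≤ p) (t : ℤ) : opF p t ^ p = 0 := by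
  have hh := qh_ne p
  have hc : opE p * opF p t ^ p = opF p t ^ p * opE p := by
    obtain ⟨n, rfl⟩ : ∃ n, p = n + 1 := ⟨p - 1, by omega⟩
    rw [comm_pow (n + 1) hp (opE _) (opF _ t) (opK _ t ^ 2) (opKi _ t ^ 2) (opEF _ hp t)]
    · rw [qnum_p _ hp]; simp
    · rw [pow_two, mul_assoc, opKF _ hp, mul_smul_comm, ← mul_assoc, opKF _ hp, smul_mul_assoc,
        smul_smul, mul_assoc, ← mul_inv, ← pow_two]
    · rw [pow_two, mul_assoc, opKiF _ hp, mul_smul_comm, ← mul_assoc, opKiF _ hp, smul_mul_assoc,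
        smul_smul, mul_assoc, ← pow_two]
  apply ww_ext
  intro a b
  have h1 : ww p a b = (opE p ^ a) (ww p 0 b) := by rw [opE_pow, zero_add]
  have h2 : Commute (opE p ^ a) (opF p t ^ p) := (show Commute _ _ from hc).pow_left a
  rw [h1, ← Module.End.mul_apply, ← h2.eq, Module.End.mul_apply, opF_pow p hp,
    ww_zero p 0 (b + p) (by omega)]
  simp


/-! ### The representation of `D` -/

def genRho (p : ℕ) (t : ℤ) : DGen → Module.End ℂ (VV p)
  | DGen.e => opE p
  | DGen.phi => opF p t
  | DGen.k => opK p t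
  | DGen.kinv => opKi p t

def rho (p : ℕ) (hp : 2 ≤ p) (t : ℤ) : Dq p →ₐ[ℂ] Module.End ℂ (VV p) :=
  RingQuot.liftAlgHom ℂ ⟨FreeAlgebra.lift ℂ (genRho p t), by
    intro x y h
    induction h with
    | epow =>
      simp only [fe, map_pow, FreeAlgebra.lift_ι_apply, genRho, map_zero]
      apply ww_ext
      intro a b
      rw [opE_pow, ww_zero _ _ _ (by omega)]
      simp
    | phipow =>
      simp only [fphi, map_pow, FreeAlgebra.lift_ι_apply, genRho, map_zero]
      exact opF_p p hp t
    | kpow =>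
      simp only [fk, map_pow, FreeAlgebra.lift_ι_apply, genRho, map_one]
      apply ww_ext
      intro a b
      rw [opK_pow, zpow_mul, zpow_natCast, (qh_prim p hp).pow_eq_one]
      simp
    | kkinv =>
      simp only [fk, fkinv, map_mul, FreeAlgebra.lift_ι_apply, genRho, map_one]
      exact opK_Ki p t
    | kinvk =>
      simp only [fk, fkinv, map_mul, FreeAlgebra.lift_ι_apply, genRho, map_one]
      exact opKi_K p t
    | ke =>
      simp only [fk, fkinv, fe, map_mul, map_smul, FreeAlgebra.lift_ι_apply, genRho]
      rw [opKE, smul_mul_assoc, mul_assoc, opK_Ki, mul_one]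
    | kphi =>
      simp only [fk, fkinv, fphi, map_mul, map_smul, FreeAlgebra.lift_ι_apply, genRho]
      rw [opKF p hp, smul_mul_assoc, mul_assoc, opK_Ki, mul_one]
    | ephi =>
      simp only [fk, fkinv, fphi, fe, map_mul, map_sub, map_pow, map_smul,
        FreeAlgebra.lift_ι_apply, genRho]
      exact opEF p hp t⟩

lemma rho_e (p : ℕ) (hp : 2 ≤ p) (t : ℤ) : rho p hp t (De p) = opE p := by
  simp [rho, De, fe, genRho]
lemma rho_phi (p : ℕ) (hp : 2 ≤ p) (t : ℤ) : rho p hp t (Dphi p) = opF p t := by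
  simp [rho, Dphi, fphi, genRho]
lemma rho_k (p : ℕ) (hp : 2 ≤ p) (t : ℤ) : rho p hp t (Dk p) = opK p t := by
  simp [rho, Dk, fk, genRho]

/-! ### Relations -/

lemma UE_pow (p : ℕ) : UE p ^ p = 0 := by
  simpa [UE] using RingQuot.mkAlgHom_rel ℂ (URel.Epow (p := p))
lemma UF_pow (p : ℕ) : UF p ^ p = 0 := by
  simpa [UF] using RingQuot.mkAlgHom_rel ℂ (URel.Fpow (p := p))
lemma UK_pow (p : ℕ) : UK p ^ (2 * p) = 1 := by
  simpa [UK] using RingQuot.mkAlgHom_rel ℂ (URel.Kpow (p := p))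
lemma UK_inv (p : ℕ) : UK p * UKinv p = 1 := by
  simpa [UK, UKinv] using RingQuot.mkAlgHom_rel ℂ (URel.KKinv (p := p))
lemma UKinv_K (p : ℕ) : UKinv p * UK p = 1 := by
  simpa [UK, UKinv] using RingQuot.mkAlgHom_rel ℂ (URel.KinvK (p := p))
lemma UKE' (p : ℕ) : UK p * UE p * UKinv p = qq p ^ 2 • UE p := by
  have h := RingQuot.mkAlgHom_rel ℂ (URel.KE (p := p))
  simp only [map_mul, map_smul] at h
  exact h
lemma UKF' (p : ℕ) : UK p * UF p * UKinv p = (qq p ^ 2)⁻¹ • UF p := by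
  have h := RingQuot.mkAlgHom_rel ℂ (URel.KF (p := p))
  simp only [map_mul, map_smul] at h
  exact h
lemma UEF (p : ℕ) : UE p * UF p - UF p * UE p
    = (qq p - (qq p)⁻¹)⁻¹ • (UK p - UKinv p) := by
  have h := RingQuot.mkAlgHom_rel ℂ (URel.EF (p := p))
  simp only [map_mul, map_smul, map_sub] at h
  exact h

lemma UKE (p : ℕ) : UK p * UE p = qq p ^ 2 • (UE p * UK p) := by
  rw [← smul_mul_assoc, ← UKE', mul_assoc, UKinv_K, mul_one]
lemma UKF (p : ℕ) : UK p * UF p = (qq p ^ 2)⁻¹ • (UF p * UK p) := by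
  rw [← smul_mul_assoc, ← UKF', mul_assoc, UKinv_K, mul_one]

lemma UKinv_eq (p : ℕ) (hp : 2 ≤ p) : UKinv p = UK p ^ (2 * p - 1) := by
  calc UKinv p = UKinv p * UK p ^ (2 * p) := by rw [UK_pow, mul_one]
    _ = UKinv p * UK p * UK p ^ (2 * p - 1) := by
      rw [mul_assoc, ← pow_succ', Nat.sub_add_cancel (by omega)]
    _ = _ := by rw [UKinv_K, one_mul]

lemma Dk_pow (p : ℕ) : Dk p ^ (4 * p) = 1 := by
  simpa [Dk] using RingQuot.mkAlgHom_rel ℂ (DRel.kpow (p := p))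
lemma Dkinv_k (p : ℕ) : Dkinv p * Dk p = 1 := by
  simpa [Dk, Dkinv] using RingQuot.mkAlgHom_rel ℂ (DRel.kinvk (p := p))
lemma Dke' (p : ℕ) : Dk p * De p * Dkinv p = qq p • De p := by
  have h := RingQuot.mkAlgHom_rel ℂ (DRel.ke (p := p))
  simp only [map_mul, map_smul] at h
  exact h
lemma Dke (p : ℕ) : Dk p * De p = qq p • (De p * Dk p) := by
  rw [← smul_mul_assoc, ← Dke', mul_assoc, Dkinv_k, mul_one]

lemma skew_pow {A : Type*} [Ring A] [Algebra ℂ A] (x K : A) (α : ℂ) (h : K * x = α • (x * K))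
    (n m : ℕ) : K ^ n * x ^ m = α ^ (n * m) • (x ^ m * K ^ n) := by
  have h1 : ∀ m, K * x ^ m = α ^ m • (x ^ m * K) := by
    intro m
    induction m with
    | zero => simp
    | succ m ih =>
      rw [pow_succ, ← mul_assoc, ih, smul_mul_assoc, mul_assoc, h, mul_smul_comm, smul_smul,
        mul_assoc, pow_succ]
  induction n with
  | zero => simp
  | succ n ih =>
    rw [pow_succ', mul_assoc, ih, mul_smul_comm, ← mul_assoc, h1, smul_mul_assoc, smul_smul,
      mul_assoc, ← pow_add, Nat.succ_mul]

/-! ### Spanning -/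

lemma span_closed {A : Type*} [Ring A] [Algebra ℂ A] (x y K : A) (α β : ℂ)
    (hx : K * x = α • (x * K)) (hy : K * y = β • (y * K)) (γ : ℂ) (N : ℕ)
    (hxy : y * x = x * y + γ • (K - K ^ N)) (S : Submodule ℂ A)
    (hS : S = Submodule.span ℂ (Set.range fun i : ℕ × ℕ × ℕ => x ^ i.1 * y ^ i.2.1 * K ^ i.2.2)) :
    (∀ z ∈ S, x * z ∈ S) ∧ (∀ z ∈ S, y * z ∈ S) ∧ (∀ z ∈ S, K * z ∈ S) := by
  have hm : ∀ a b c, x ^ a * y ^ b * K ^ c ∈ S := fun a b c => by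
    rw [hS]; exact Submodule.subset_span ⟨(a, b, c), rfl⟩
  have red : ∀ u : A, (∀ a b c, u * (x ^ a * y ^ b * K ^ c) ∈ S) → ∀ z ∈ S, u * z ∈ S := by
    intro u hu z hz
    rw [hS] at hz
    induction hz using Submodule.span_induction with
    | mem z hz => obtain ⟨i, rfl⟩ := hz; exact hu _ _ _
    | zero => simp
    | add z z' _ _ h h' => rw [mul_add]; exact S.add_mem h h'
    | smul r z _ h => rw [mul_smul_comm]; exact S.smul_mem r h
  have hX : ∀ z ∈ S, x * z ∈ S := red x fun a b c => by
    rw [← mul_assoc, ← mul_assoc, ← pow_succ']; exact hm _ _ _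
  have hK : ∀ z ∈ S, K * z ∈ S := red K fun a b c => by
    have h1 := skew_pow x K α hx 1 a
    have h2 := skew_pow y K β hy 1 b
    rw [pow_one] at h1 h2
    rw [← mul_assoc, ← mul_assoc, h1, smul_mul_assoc, smul_mul_assoc, mul_assoc (x ^ a) K, h2,
      mul_smul_comm, smul_mul_assoc, ← mul_assoc, mul_assoc _ K, ← pow_succ']
    exact S.smul_mem _ (S.smul_mem _ (hm _ _ _))
  have hKn : ∀ n, ∀ z ∈ S, K ^ n * z ∈ S := by
    intro n
    induction n with
    | zero => simp
    | succ n ih => intro z hz; rw [pow_succ, mul_assoc]; exact ih _ (hK z hz)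
  refine ⟨hX, red y fun a b c => ?_, hK⟩
  induction a with
  | zero =>
    rw [pow_zero, one_mul, ← mul_assoc, ← pow_succ']
    simpa using hm 0 (b + 1) c
  | succ a ih =>
    have : y * (x ^ (a + 1) * y ^ b * K ^ c) = x * (y * (x ^ a * y ^ b * K ^ c))
        + γ • (K * (x ^ a * y ^ b * K ^ c) - K ^ N * (x ^ a * y ^ b * K ^ c)) := by
      rw [pow_succ', mul_assoc x, mul_assoc x, ← mul_assoc y, hxy, add_mul, smul_mul_assoc, sub_mul,
        mul_assoc]
    rw [this]
    exact S.add_mem (hX _ ih) (S.smul_mem _ (S.sub_mem (hK _ (hm _ _ _)) (hKn _ _ (hm _ _ _))))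

lemma U_induction (p : ℕ) (P : Uq p → Prop) (hs : ∀ r : ℂ, P (algebraMap ℂ _ r))
    (hE : P (UE p)) (hF : P (UF p)) (hK : P (UK p)) (hKi : P (UKinv p))
    (hm : ∀ x y, P x → P y → P (x * y)) (ha : ∀ x y, P x → P y → P (x + y)) (u : Uq p) : P u := by
  obtain ⟨x, rfl⟩ := RingQuot.mkAlgHom_surjective ℂ (URel p) u
  induction x using FreeAlgebra.induction with
  | grade0 r => rw [AlgHom.commutes]; exact hs r
  | grade1 x => cases x <;> assumption
  | mul a b h h' => rw [map_mul]; exact hm _ _ h h'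
  | add a b h h' => rw [map_add]; exact ha _ _ h h'

lemma U_span (p : ℕ) (hp : 2 ≤ p) :
    Submodule.span ℂ (Set.range fun i : ℕ × ℕ × ℕ => UF p ^ i.1 * UE p ^ i.2.1 * UK p ^ i.2.2)
      = ⊤ := by
  set S := Submodule.span ℂ
    (Set.range fun i : ℕ × ℕ × ℕ => UF p ^ i.1 * UE p ^ i.2.1 * UK p ^ i.2.2) with hS
  obtain ⟨h1, h2, h3⟩ := span_closed (UF p) (UE p) (UK p) _ _ (UKF p) (UKE p)
    (qq p - (qq p)⁻¹)⁻¹ (2 * p - 1) (by rw [← UKinv_eq p hp, ← UEF]; abel) S hS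
  have h4 : ∀ n, ∀ z ∈ S, UK p ^ n * z ∈ S := by
    intro n
    induction n with
    | zero => simp
    | succ n ih => intro z hz; rw [pow_succ, mul_assoc]; exact ih _ (h3 z hz)
  have key : ∀ u : Uq p, ∀ z ∈ S, u * z ∈ S := by
    apply U_induction
    · intro r z hz
      rw [← Algebra.smul_def]; exact S.smul_mem r hz
    · exact h2
    · exact h1
    · exact h3
    · rw [UKinv_eq p hp]; exact h4 _
    · intro x y hx hy z hz
      rw [mul_assoc]; exact hx _ (hy _ hz)
    · intro x y hx hy z hz
      rw [add_mul]; exact S.add_mem (hx _ hz) (hy _ hz)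
  rw [eq_top_iff]
  intro u _
  have : (1 : Uq p) ∈ S := by
    rw [hS]; exact Submodule.subset_span ⟨(0, 0, 0), by simp⟩
  simpa using key u 1 this

lemma U_finite (p : ℕ) (hp : 2 ≤ p) : Module.Finite ℂ (Uq p) := by
  classical
  refine ⟨⟨(Finset.image (fun i : ℕ × ℕ × ℕ => UF p ^ i.1 * UE p ^ i.2.1 * UK p ^ i.2.2)
    (range p ×ˢ range p ×ˢ range (2 * p))), ?_⟩⟩
  rw [eq_top_iff, ← U_span p hp, Submodule.span_le]
  rintro _ ⟨⟨a, b, c⟩, rfl⟩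
  have z : ∀ (x : Uq p) (a : ℕ), x ^ p = 0 → ¬ a < p → x ^ a = 0 := by
    intro x a h ha
    rw [← Nat.sub_add_cancel (not_lt.1 ha), pow_add, h, mul_zero]
  by_cases ha : a < p
  · by_cases hb : b < p
    · apply Submodule.subset_span
      rw [Finset.coe_image]
      refine ⟨(a, b, c % (2 * p)), ?_, ?_⟩
      · simp [ha, hb]
        exact Nat.mod_lt _ (by omega)
      · simp only [← pow_eq_pow_mod c (UK_pow p)]
    · simp [z _ _ (UE_pow p) hb]
  · simp [z _ _ (UF_pow p) ha]

/-! ### A retraction of `ι` -/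

def genPsi (p : ℕ) : DGen → Matrix (Fin 2) (Fin 2) (Uq p)
  | DGen.e => !![UE p, 0; 0, (qq p)⁻¹ • UE p]
  | DGen.phi => !![UF p, 0; 0, qq p • UF p]
  | DGen.k => !![0, UK p; 1, 0]
  | DGen.kinv => !![0, 1; UKinv p, 0]

lemma diag_pow {A : Type*} [Ring A] (a b : A) (n : ℕ) :
    (!![a, 0; 0, b] : Matrix (Fin 2) (Fin 2) A) ^ n = !![a ^ n, 0; 0, b ^ n] := by
  induction n with
  | zero => simp [Matrix.one_fin_two]
  | succ n ih => rw [pow_succ, ih]; simp [pow_succ]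

lemma genPsi_k2 (p : ℕ) : genPsi p DGen.k ^ 2 = !![UK p, 0; 0, UK p] := by
  simp [genPsi, pow_two]

lemma genPsi_ki2 (p : ℕ) : genPsi p DGen.kinv ^ 2 = !![UKinv p, 0; 0, UKinv p] := by
  simp [genPsi, pow_two]

def psi (p : ℕ) (hp : 2 ≤ p) : Dq p →ₐ[ℂ] Matrix (Fin 2) (Fin 2) (Uq p) :=
  RingQuot.liftAlgHom ℂ ⟨FreeAlgebra.lift ℂ (genPsi p), by
    have hq := qq_ne p
    intro x y h
    induction h with
    | epow =>
      simp only [fe, map_pow, FreeAlgebra.lift_ι_apply, genPsi, map_zero]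
      rw [diag_pow, smul_pow, UE_pow, smul_zero]
      ext i j; fin_cases i <;> fin_cases j <;> rfl
    | phipow =>
      simp only [fphi, map_pow, FreeAlgebra.lift_ι_apply, genPsi, map_zero]
      rw [diag_pow, smul_pow, UF_pow, smul_zero]
      ext i j; fin_cases i <;> fin_cases j <;> rfl
    | kpow =>
      simp only [fk, map_pow, FreeAlgebra.lift_ι_apply, map_one]
      rw [show 4 * p = 2 * (2 * p) by ring, pow_mul, genPsi_k2, diag_pow, UK_pow,
        Matrix.one_fin_two]
    | kkinv =>
      simp [fk, fkinv, genPsi, UK_inv, Matrix.one_fin_two]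
    | kinvk =>
      simp [fk, fkinv, genPsi, UKinv_K, Matrix.one_fin_two]
    | ke =>
      simp only [fk, fkinv, fe, map_mul, map_smul, FreeAlgebra.lift_ι_apply, genPsi]
      simp [UKE', smul_smul, hq]
      congr 1; field_simp
    | kphi =>
      simp only [fk, fkinv, fphi, map_mul, map_smul, FreeAlgebra.lift_ι_apply, genPsi]
      simp [UKF', smul_smul, hq]
      congr 1; field_simp
    | ephi =>
      simp only [fk, fkinv, fphi, fe, map_mul, map_sub, map_pow, map_smul,
        FreeAlgebra.lift_ι_apply, genPsi_k2, genPsi_ki2]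
      simp [genPsi, smul_smul, hq, UEF]⟩

lemma psi_e (p : ℕ) (hp : 2 ≤ p) : psi p hp (De p) = genPsi p DGen.e := by
  simp [psi, De, fe]
lemma psi_phi (p : ℕ) (hp : 2 ≤ p) : psi p hp (Dphi p) = genPsi p DGen.phi := by
  simp [psi, Dphi, fphi]
lemma psi_k (p : ℕ) (hp : 2 ≤ p) : psi p hp (Dk p) = genPsi p DGen.k := by
  simp [psi, Dk, fk]
lemma psi_kinv (p : ℕ) (hp : 2 ≤ p) : psi p hp (Dkinv p) = genPsi p DGen.kinv := by
  simp [psi, Dkinv, fkinv]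

lemma psi_iota (p : ℕ) (hp : 2 ≤ p) (ι : Uq p →ₐ[ℂ] Dq p) (hι : IsIota p ι) (u : Uq p) :
    ∃ v, psi p hp (ι u) = !![u, 0; 0, v] := by
  obtain ⟨h1, h2, h3, h4⟩ := hι
  induction u using U_induction with
  | hs r =>
    refine ⟨algebraMap ℂ _ r, ?_⟩
    rw [AlgHom.commutes, AlgHom.commutes]
    ext i j; fin_cases i <;> fin_cases j <;> simp [Matrix.algebraMap_matrix_apply]
  | hE => exact ⟨_, by rw [h1, psi_e]; rfl⟩
  | hF => exact ⟨_, by rw [h2, psi_phi]; rfl⟩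
  | hK => exact ⟨_, by rw [h3, map_pow, psi_k, genPsi_k2]⟩
  | hKi => exact ⟨_, by rw [h4, map_pow, psi_kinv, genPsi_ki2]⟩
  | hm x y hx hy =>
    obtain ⟨a, ha⟩ := hx
    obtain ⟨b, hb⟩ := hy
    exact ⟨a * b, by rw [map_mul, map_mul, ha, hb]; simp⟩
  | ha x y hx hy =>
    obtain ⟨a, ha⟩ := hx
    obtain ⟨b, hb⟩ := hy
    exact ⟨a + b, by rw [map_add, map_add, ha, hb]; simp⟩

/-- every functional on `U` extends to `D` -/
lemma exists_ext (p : ℕ) (hp : 2 ≤ p) (ι : Uq p →ₐ[ℂ] Dq p) (hι : IsIota p ι)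
    (f : Module.Dual ℂ (Uq p)) : ∃ g : Module.Dual ℂ (Dq p), ∀ u, g (ι u) = f u := by
  refine ⟨f ∘ₗ (Matrix.entryLinearMap ℂ (Uq p) 0 0) ∘ₗ (psi p hp).toLinearMap, fun u => ?_⟩
  obtain ⟨v, hv⟩ := psi_iota p hp ι hι u
  simp [hv]


/-! ### The main computation -/

def act (p : ℕ) (hp : 2 ≤ p) (t : ℤ) :
    Dq p ⊗[ℂ] Dq p →ₐ[ℂ] Module.End ℂ (Dq p ⊗[ℂ] VV p) :=
  (Module.endTensorEndAlgHom (R := ℂ) (A := ℂ) (M := Dq p) (N := VV p)).comp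
    (Algebra.TensorProduct.map (Algebra.lmul ℂ (Dq p)) (rho p hp t))

lemma act_tmul (p : ℕ) (hp : 2 ≤ p) (t : ℤ) (x y z : Dq p) (v : VV p) :
    act p hp t (x ⊗ₜ y) (z ⊗ₜ v) = (x * z) ⊗ₜ (rho p hp t y v) := by
  rfl

lemma act_contract (p : ℕ) (hp : 2 ≤ p) (t : ℤ) (g : Module.Dual ℂ (Dq p)) (v : VV p)
    (X : Dq p ⊗[ℂ] Dq p) :
    TensorProduct.lid ℂ (VV p) (TensorProduct.map g LinearMap.id (act p hp t X (1 ⊗ₜ v)))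
      = rho p hp t (TensorProduct.lid ℂ (Dq p) (TensorProduct.map g LinearMap.id X)) v := by
  induction X using TensorProduct.induction_on with
  | zero => simp
  | tmul x y => simp [act_tmul]
  | add x y hx hy => simp only [map_add, LinearMap.add_apply, hx, hy]

def rr (p m : ℕ) : ℂ := (qq p - (qq p)⁻¹) ^ m / qfac p m

lemma rr_ne (p : ℕ) (hp : 2 ≤ p) (m : ℕ) (hm : m < p) : rr p m ≠ 0 :=
  div_ne_zero (pow_ne_zero _ (del_ne p hp)) (qfac_ne p hp m hm)

/-- reduction mod `4p` -/
def md (p : ℕ) (s : ℤ) : ℕ := (s % (4 * p : ℕ)).toNat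

lemma act_R (p : ℕ) (hp : 2 ≤ p) (t : ℤ) :
    act p hp t (Rmat p) (1 ⊗ₜ ww p 0 0) = ∑ l ∈ range p,
      (rr p l * qh p ^ ((l : ℤ) * (l - 1) + 2 * l * md p (t - 2 * l))) •
        ((De p ^ l * Dk p ^ md p (t - 2 * l)) ⊗ₜ[ℂ] ww p 0 l) := by
  have hh := qh_ne p
  have h4 : (4 * (p : ℂ)) ≠ 0 := by
    have : (p : ℂ) ≠ 0 := by exact_mod_cast (by omega : p ≠ 0)
    simpa using this
  unfold Rmat md
  rw [map_smul, LinearMap.smul_apply, inv_smul_eq_iff₀ h4, Finset.smul_sum]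
  simp only [map_sum, LinearMap.sum_apply, map_smul, LinearMap.smul_apply, act_tmul, mul_one]
  refine Finset.sum_congr rfl fun l _ => ?_
  rw [← sum_char p hp (t - 2 * l) (fun n => (rr p l * qh p ^ ((l : ℤ) * (l - 1) + 2 * l * n)) •
        ((De p ^ l * Dk p ^ n) ⊗ₜ[ℂ] ww p 0 l))]
  refine Finset.sum_congr rfl fun n _ => Finset.sum_congr rfl fun j _ => ?_
  rw [map_mul, map_pow, map_pow, rho_phi, rho_k, Module.End.mul_apply, opK_pow, map_smul,
    opF_pow p hp, zero_add, TensorProduct.tmul_smul, smul_smul, smul_smul, ← rr, mul_assoc,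
    ← zpow_add₀ hh, mul_left_comm, ← zpow_add₀ hh]
  congr 3
  push_cast; ring

lemma act_R21 (p : ℕ) (hp : 2 ≤ p) (t : ℤ) (x : Dq p) (l : ℕ) :
    act p hp t (R21 p) (x ⊗ₜ ww p 0 l) = ∑ m ∈ range p,
      (rr p m * qh p ^ ((m : ℤ) * (m - 1) - 2 * m * md p (t - 2 * l + 2 * m))) •
        ((Dphi p ^ m * Dk p ^ md p (t - 2 * l + 2 * m) * x) ⊗ₜ[ℂ] ww p m l) := by
  have hh := qh_ne p
  have h4 : (4 * (p : ℂ)) ≠ 0 := by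
    have : (p : ℂ) ≠ 0 := by exact_mod_cast (by omega : p ≠ 0)
    simpa using this
  unfold R21 Rmat md
  rw [map_smul, map_smul, LinearMap.smul_apply, inv_smul_eq_iff₀ h4, Finset.smul_sum]
  simp only [map_sum, LinearMap.sum_apply, map_smul, LinearMap.smul_apply,
    TensorProduct.comm_tmul, act_tmul]
  refine Finset.sum_congr rfl fun m _ => ?_
  rw [← sum_char p hp (t - 2 * l + 2 * m)
    (fun j => (rr p m * qh p ^ ((m : ℤ) * (m - 1) - 2 * m * j)) •
        ((Dphi p ^ m * Dk p ^ j * x) ⊗ₜ[ℂ] ww p m l)), Finset.sum_comm]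
  refine Finset.sum_congr rfl fun j _ => Finset.sum_congr rfl fun n _ => ?_
  rw [map_mul, map_pow, map_pow, rho_e, rho_k, Module.End.mul_apply, opK_pow, map_smul,
    opE_pow, zero_add, TensorProduct.tmul_smul, smul_smul, smul_smul, ← rr, mul_assoc,
    ← zpow_add₀ hh, mul_left_comm, ← zpow_add₀ hh]
  congr 3
  push_cast; ring

lemma vanish (p : ℕ) (hp : 2 ≤ p) (g : Module.Dual ℂ (Dq p))
    (hg : TensorProduct.lid ℂ (Dq p) (TensorProduct.map g LinearMap.id (Mmat p)) = 0)
    (t : ℤ) (m l : ℕ) (hm : m < p) (hl : l < p) :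
    g (Dphi p ^ m * De p ^ l * Dk p ^ (md p (t - 2 * l + 2 * m) + md p (t - 2 * l))) = 0 := by
  have h := act_contract p hp t g (ww p 0 0) (Mmat p)
  rw [hg, map_zero, Mmat, map_mul, Module.End.mul_apply, act_R] at h
  simp only [map_sum, map_smul, act_R21, TensorProduct.map_tmul, TensorProduct.lid_tmul,
    LinearMap.id_apply, LinearMap.zero_apply] at h
  have h' := DFunLike.congr_fun h ((⟨m, hm⟩, ⟨l, hl⟩) : Fin p × Fin p)
  have hw : ∀ a ∈ range p, ∀ b ∈ range p,
      (ww p b a) ((⟨m, hm⟩, ⟨l, hl⟩) : Fin p × Fin p) = if a = l then (if b = m then 1 else 0) else 0 := by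
    intro a ha b hb
    rw [Finset.mem_range] at ha hb
    simp only [ww, ha, hb, and_self, dite_true, Finsupp.single_apply, Prod.mk.injEq, Fin.mk.injEq]
    split_ifs <;> simp_all
  simp only [Finsupp.coe_finsetSum, Finset.sum_apply, Finsupp.smul_apply, Finsupp.coe_zero,
    Pi.zero_apply] at h'
  rw [Finset.sum_eq_single l, Finset.sum_eq_single m] at h'
  · rw [hw l (Finset.mem_range.2 hl) m (Finset.mem_range.2 hm)] at h'
    simp only [if_true, smul_eq_mul, mul_one, mul_eq_zero, rr_ne p hp m hm, rr_ne p hp l hl,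
      zpow_ne_zero _ (qh_ne p), false_or] at h'
    rw [mul_assoc (Dphi p ^ m), ← mul_assoc (Dk p ^ _), skew_pow _ _ _ (Dke p), smul_mul_assoc,
      mul_smul_comm, map_smul, smul_eq_mul, mul_eq_zero] at h'
    rcases h' with h' | h'
    · exact absurd h' (pow_ne_zero _ (qq_ne p))
    · rw [← h', mul_assoc, mul_assoc, ← pow_add]
  · intro b hb hne
    rw [hw l (Finset.mem_range.2 hl) b hb]
    simp [hne]
  · intro hn; exact absurd (Finset.mem_range.2 hm) hn
  · intro a ha hne
    rw [Finset.sum_eq_zero, smul_zero]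
    intro b hb
    rw [hw a ha b hb]
    simp [hne]
  · intro hn; exact absurd (Finset.mem_range.2 hl) hn

lemma md_pow (p : ℕ) (hp : 2 ≤ p) (t : ℤ) (c m l : ℕ) (ht : t = c - m + 2 * l) :
    Dk p ^ (md p (t - 2 * l + 2 * m) + md p (t - 2 * l)) = (Dk p ^ 2) ^ c := by
  rw [← pow_mul, pow_eq_pow_mod (2 * c) (Dk_pow p), pow_eq_pow_mod _ (Dk_pow p)]
  congr 1
  have h1 : ∀ s, ((md p s : ℕ) : ℤ) = s % (4 * p : ℕ) := fun s =>
    Int.toNat_of_nonneg (Int.emod_nonneg _ (by omega))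
  zify
  rw [h1, h1]
  push_cast
  rw [← Int.add_emod]
  rw [ht]
  congr 1
  ring

lemma inj_aux (p : ℕ) (hp : 2 ≤ p) (ι : Uq p →ₐ[ℂ] Dq p) (hι : IsIota p ι)
    (MU : Uq p ⊗[ℂ] Uq p) (hM : TensorProduct.map ι.toLinearMap ι.toLinearMap MU = Mmat p)
    (f : Module.Dual ℂ (Uq p))
    (hf : TensorProduct.lid ℂ (Uq p) (TensorProduct.map f LinearMap.id MU) = 0) : f = 0 := by
  obtain ⟨g, hg⟩ := exists_ext p hp ι hι f
  have h0 : TensorProduct.lid ℂ (Dq p) (TensorProduct.map g LinearMap.id (Mmat p)) = 0 := by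
    have : ∀ X : Uq p ⊗[ℂ] Uq p, TensorProduct.lid ℂ (Dq p) (TensorProduct.map g LinearMap.id
        (TensorProduct.map ι.toLinearMap ι.toLinearMap X))
        = ι (TensorProduct.lid ℂ (Uq p) (TensorProduct.map f LinearMap.id X)) := by
      intro X
      induction X using TensorProduct.induction_on with
      | zero => simp
      | tmul x y => simp [hg]
      | add x y hx hy => simp only [map_add, hx, hy]
    rw [← hM, this, hf, map_zero]
  obtain ⟨h1, h2, h3, h4⟩ := hι
  have z : ∀ (x : Uq p) (a : ℕ), x ^ p = 0 → ¬ a < p → x ^ a = 0 := by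
    intro x a h ha
    rw [← Nat.sub_add_cancel (not_lt.1 ha), pow_add, h, mul_zero]
  apply LinearMap.ext_on_range (U_span p hp)
  rintro ⟨m, l, c⟩
  by_cases hm : m < p
  · by_cases hl : l < p
    · have := vanish p hp g h0 (c - m + 2 * l) m l hm hl
      rw [md_pow p hp _ c m l rfl, ← h1, ← h2, ← h3, ← map_pow, ← map_pow, ← map_pow, ← map_mul,
        ← map_mul, hg] at this
      simpa using this
    · simp [z _ _ (UE_pow p) hl]
  · simp [z _ _ (UF_pow p) hm]

end LogHennings
open LogHennings in
/-- `U` is factorizable: writing `M_U ∈ U ⊗ U` for the element with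
`(ι ⊗ ι)(M_U) = R₂₁ R`, the map `U* → U`, `f ↦ (f ⊗ id)(M_U)`, is bijective. -/
theorem U_is_factorizable (p : ℕ) (hp : 2 ≤ p) :
    ∀ ι : Uq p →ₐ[ℂ] Dq p, IsIota p ι →
      ∀ MU : Uq p ⊗[ℂ] Uq p,
        TensorProduct.map ι.toLinearMap ι.toLinearMap MU = Mmat p →
        Function.Bijective (fun f : Module.Dual ℂ (Uq p) =>
          TensorProduct.lid ℂ (Uq p)
            (TensorProduct.map f LinearMap.id MU)) := by
  intro ι hι MU hM
  haveI := U_finite p hp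
  let T : Module.Dual ℂ (Uq p) →ₗ[ℂ] Uq p :=
    { toFun := fun f => TensorProduct.lid ℂ (Uq p) (TensorProduct.map f LinearMap.id MU)
      map_add' := fun f g => by
        rw [TensorProduct.map_add_left, LinearMap.add_apply, map_add]
      map_smul' := fun r f => by
        rw [TensorProduct.map_smul_left, LinearMap.smul_apply, map_smul, RingHom.id_apply] }
  have hinj : Function.Injective T := by
    rw [injective_iff_map_eq_zero]
    intro f hf
    exact inj_aux p hp ι hι MU hM f hf
  exact ⟨hinj, (LinearMap.injective_iff_surjective_of_finrank_eq_finrank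
    Subspace.dual_finrank_eq).1 hinj⟩
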